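/- arXiv:1507.08080 — 2 statements merged into one kernel-verified Lean document; each statement's English description precedes it below -/
import Mathlib

section
/- Let n ≥ 5 and let P, Q : Fin n → ℝ² be two configurations of labeled points (injective, in general position) that have the same undirected radial system, i.e., for every index i the relation ccw_Q(i;·,·,·) equals ccw_P(i;·,·,·) or its reverse. Then either ccw_P(i;j,k,l) ↔ ccw_Q(i;j,k,l) for all admissible i,j,k,l, or ccw_P(i;j,k,l) ↔ ccw_Q(i;l,k,j) for all admissible i,j,k,l. In other words, the undirected radial system determines the (directed) radial system up to complete reversal. -/
noncomputable def det2 (v w : ℝ × ℝ) : ℝ := v.1 * w.2 - v.2 * w.1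

noncomputable def chi {α : Type*} (P : α → ℝ × ℝ) (i j k : α) : ℝ :=
  Real.sign (det2 (P j - P i) (P k - P i))

def GenPos {α : Type*} (P : α → ℝ × ℝ) : Prop :=
  ∀ i j k : α, i ≠ j → i ≠ k → j ≠ k → chi P i j k ≠ 0

def Ccw {α : Type*} (P : α → ℝ × ℝ) (i j k l : α) : Prop :=
  (chi P i j k = 1 ∧ chi P i k l = 1) ∨
  (chi P i k l = 1 ∧ chi P i l j = 1) ∨
  (chi P i l j = 1 ∧ chi P i j k = 1)

def Admissible {α : Type*} (i j k l : α) : Prop :=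
  i ≠ j ∧ i ≠ k ∧ i ≠ l ∧ j ≠ k ∧ j ≠ l ∧ k ≠ l

def SameRadial {α : Type*} (P Q : α → ℝ × ℝ) : Prop :=
  ∀ i j k l : α, Admissible i j k l → (Ccw P i j k l ↔ Ccw Q i j k l)

def SameUndirected {α : Type*} (P Q : α → ℝ × ℝ) : Prop :=
  ∀ i : α, (∀ j k l : α, Admissible i j k l → (Ccw Q i j k l ↔ Ccw P i j k l)) ∨
           (∀ j k l : α, Admissible i j k l → (Ccw Q i j k l ↔ Ccw P i l k j))

def ExtremeSet {α : Type*} (P : α → ℝ × ℝ) : Set α :=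
  {i | P i ∉ convexHull ℝ (P '' {j | j ≠ i})}

def Important {n : ℕ} (P₀ : Fin n → ℝ × ℝ) (H : Set (Fin n)) : Prop :=
  ∃ Q : Fin n → ℝ × ℝ, Function.Injective Q ∧ GenPos Q ∧ SameRadial P₀ Q ∧ ExtremeSet Q = H

def lineThrough (p q : ℝ × ℝ) : Set (ℝ × ℝ) := {x | ∃ t : ℝ, x = p + t • (q - p)}

lemma chi_eq_one_iff {α : Type*} (P : α → ℝ × ℝ) (i j k : α) :
    chi P i j k = 1 ↔ 0 < det2 (P j - P i) (P k - P i) := by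
  unfold chi
  rcases lt_trichotomy (det2 (P j - P i) (P k - P i)) 0 with h | h | h
  · rw [Real.sign_of_neg h]
    exact ⟨fun h' => by norm_num at h', fun h' => absurd h' h.not_gt⟩
  · simp [h]
  · simp [Real.sign_of_pos h, h]

lemma GenPos.det2_ne_zero {α : Type*} {P : α → ℝ × ℝ} (hP : GenPos P) {i j k : α}
    (hij : i ≠ j) (hik : i ≠ k) (hjk : j ≠ k) : det2 (P j - P i) (P k - P i) ≠ 0 := by
  intro h
  exact hP i j k hij hik hjk (by simp [chi, h])

lemma det2_sub_swap {α : Type*} (P : α → ℝ × ℝ) (i j k : α) :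
    det2 (P k - P i) (P j - P i) = -det2 (P j - P i) (P k - P i) := by
  simp only [det2]
  ring

lemma det2_sub_rotate {α : Type*} (P : α → ℝ × ℝ) (i j k : α) :
    det2 (P k - P j) (P i - P j) = det2 (P j - P i) (P k - P i) := by
  simp only [det2, Prod.fst_sub, Prod.snd_sub]
  ring

lemma GenPos.ccw_reverse_iff {α : Type*} {P : α → ℝ × ℝ} (hP : GenPos P) {i j k l : α}
    (h : Admissible i j k l) : Ccw P i l k j ↔ ¬ Ccw P i j k l := by
  obtain ⟨hij, hik, hil, hjk, hjl, hkl⟩ := h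
  have hA := hP.det2_ne_zero hij hik hjk
  have hB := hP.det2_ne_zero hik hil hkl
  have hC := hP.det2_ne_zero hil hij hjl.symm
  simp only [Ccw, chi_eq_one_iff]
  rw [det2_sub_swap P i j k, det2_sub_swap P i k l, det2_sub_swap P i l j]
  rcases hA.lt_or_gt with hA | hA <;> rcases hB.lt_or_gt with hB | hB <;>
    rcases hC.lt_or_gt with hC | hC <;> simp [hA, hB, hC, hA.not_gt, hB.not_gt, hC.not_gt]

/-- Among the four radial orders of four points, taken in this labelling, an even number is
counterclockwise. -/
lemma GenPos.ccw_parity {α : Type*} {P : α → ℝ × ℝ} (hP : GenPos P) {a b c d : α}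
    (h : Admissible a b c d) :
    (Ccw P a b c d ↔ Ccw P b a c d) ↔ (Ccw P c a b d ↔ Ccw P d a b c) := by
  obtain ⟨hab, hac, had, hbc, hbd, hcd⟩ := h
  have hA := hP.det2_ne_zero hab hac hbc
  have hB := hP.det2_ne_zero hab had hbd
  have hC := hP.det2_ne_zero hac had hcd
  have hD := hP.det2_ne_zero hbc hbd hcd
  have hsum : det2 (P c - P b) (P d - P b) + det2 (P b - P a) (P d - P a) =
      det2 (P c - P a) (P d - P a) + det2 (P b - P a) (P c - P a) := by
    simp only [det2, Prod.fst_sub, Prod.snd_sub]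
    ring
  simp only [Ccw, chi_eq_one_iff]
  rw [det2_sub_swap P a b d, det2_sub_swap P b c a, det2_sub_swap P c d b,
    det2_sub_swap P d a c, det2_sub_rotate P c d b, det2_sub_rotate P c d a,
    det2_sub_rotate P b d a, det2_sub_rotate P b c a, det2_sub_rotate P b c d,
    det2_sub_rotate P a c d, det2_sub_rotate P a b d, det2_sub_rotate P a b c]
  generalize det2 (P b - P a) (P c - P a) = A at *
  generalize det2 (P b - P a) (P d - P a) = B at *
  generalize det2 (P c - P a) (P d - P a) = C at *
  generalize det2 (P c - P b) (P d - P b) = D at *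
  rcases hA.lt_or_gt with hA | hA <;> rcases hB.lt_or_gt with hB | hB <;>
    rcases hC.lt_or_gt with hC | hC <;> rcases hD.lt_or_gt with hD | hD <;>
    first
    | (exfalso; linarith)
    | simp [hA, hB, hC, hD, hA.not_gt, hB.not_gt, hC.not_gt, hD.not_gt]

/-- the undirected radial system determines the directed radial
system up to complete reversal. -/
theorem undirected_determines_directed {n : ℕ} (hn : 5 ≤ n)
    (P Q : Fin n → ℝ × ℝ)
    (hPinj : Function.Injective P) (hPgp : GenPos P)
    (hQinj : Function.Injective Q) (hQgp : GenPos Q)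
    (hU : SameUndirected P Q) :
    (∀ i j k l : Fin n, Admissible i j k l → (Ccw P i j k l ↔ Ccw Q i j k l)) ∨
    (∀ i j k l : Fin n, Admissible i j k l → (Ccw P i j k l ↔ Ccw Q i l k j)) := by
  have hs : ∀ i, ∃ s : Prop, ∀ j k l, Admissible i j k l →
      (Ccw Q i j k l ↔ (Ccw P i j k l ↔ s)) := by
    intro i
    rcases hU i with h | h
    · exact ⟨True, fun j k l hadm => by simpa using h j k l hadm⟩
    · exact ⟨False, fun j k l hadm => by
        rw [h j k l hadm, hPgp.ccw_reverse_iff hadm, iff_false]⟩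
  choose s hs using hs
  have hpar : ∀ a b c d, Admissible a b c d → ((s a ↔ s b) ↔ (s c ↔ s d)) := by
    intro a b c d h
    have hP := hPgp.ccw_parity h
    have hQ := hQgp.ccw_parity h
    obtain ⟨hab, hac, had, hbc, hbd, hcd⟩ := h
    rw [hs a b c d ⟨hab, hac, had, hbc, hbd, hcd⟩,
      hs b a c d ⟨hab.symm, hbc, hbd, hac, had, hcd⟩,
      hs c a b d ⟨hac.symm, hbc.symm, hcd, hab, had, hbd⟩,
      hs d a b c ⟨had.symm, hbd.symm, hcd.symm, hab, hac, hbc⟩] at hQ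
    grind
  have hconst : ∀ a b, s a ↔ s b := by
    intro a b
    rcases eq_or_ne a b with rfl | hab
    · rfl
    have hcard : 2 < (Finset.univ \ {a, b} : Finset (Fin n)).card := by
      rw [Finset.card_sdiff_of_subset (Finset.subset_univ _), Finset.card_univ, Fintype.card_fin,
        Finset.card_pair hab]
      omega
    obtain ⟨c, hc, d, hd, e, he, hcd, hce, hde⟩ := Finset.two_lt_card.mp hcard
    simp only [Finset.mem_sdiff, Finset.mem_univ, true_and, Finset.mem_insert,
      Finset.mem_singleton, not_or, ← ne_eq] at hc hd he
    have h₁ := hpar a b c d ⟨hab, hc.1.symm, hd.1.symm, hc.2.symm, hd.2.symm, hcd⟩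
    have h₂ := hpar a b c e ⟨hab, hc.1.symm, he.1.symm, hc.2.symm, he.2.symm, hce⟩
    have h₃ := hpar a b d e ⟨hab, hd.1.symm, he.1.symm, hd.2.symm, he.2.symm, hde⟩
    grind
  by_cases h : ∀ i, s i
  · left
    intro i j k l hadm
    simpa [h i] using (hs i j k l hadm).symm
  · right
    obtain ⟨a, ha⟩ := not_forall.mp h
    intro i j k l hadm
    have hi : ¬ s i := fun hi => ha ((hconst i a).mp hi)
    rw [hQgp.ccw_reverse_iff hadm, hs i j k l hadm]
    simp [hi]
end

section
/- Let P, Q : Fin 4 → ℝ² be two configurations of 4 labeled points (injective, in general position). Then the number of indices i ∈ Fin 4 at which the counterclockwise radial relation of P differs from that of Q (equivalently, at which ccw_Q(i;·,·,·) is the reverse of ccw_P(i;·,·,·), since on three elements any two cyclic orders are equal or reversed) is even. -/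
theorem chi_rotate {α : Type*} (P : α → ℝ × ℝ) (i j k : α) : chi P i j k = chi P j k i := by
  unfold chi det2
  congr 1
  simp only [Prod.fst_sub, Prod.snd_sub]
  ring

theorem chi_swap {α : Type*} (P : α → ℝ × ℝ) (i j k : α) : chi P i k j = -chi P i j k := by
  unfold chi det2
  rw [← Real.sign_neg]
  congr 1
  ring

theorem GenPos.chi_eq {α : Type*} {P : α → ℝ × ℝ} (h : GenPos P) {i j k : α}
    (hij : i ≠ j) (hik : i ≠ k) (hjk : j ≠ k) : chi P i j k = -1 ∨ chi P i j k = 1 := by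
  have h0 := h i j k hij hik hjk
  rcases Real.sign_apply_eq (det2 (P j - P i) (P k - P i)) with h1 | h1 | h1
  · exact Or.inl h1
  · exact absurd h1 h0
  · exact Or.inr h1

theorem ccw_rotate {α : Type*} (P : α → ℝ × ℝ) (i j k l : α) :
    Ccw P i k l j ↔ Ccw P i j k l := by
  unfold Ccw
  tauto

theorem GenPos.ccw_reverse {α : Type*} {P : α → ℝ × ℝ} (h : GenPos P) {i j k l : α}
    (hA : Admissible i j k l) : Ccw P i l k j ↔ ¬ Ccw P i j k l := by
  obtain ⟨hij, hik, hil, hjk, hjl, hkl⟩ := hA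
  unfold Ccw
  rw [chi_swap P i k l, chi_swap P i j k, chi_swap P i l j]
  rcases h.chi_eq hij hik hjk with h1 | h1 <;> rcases h.chi_eq hik hil hkl with h2 | h2 <;>
    rcases h.chi_eq hil hij hjl.symm with h3 | h3 <;> rw [h1, h2, h3] <;> norm_num

theorem Admissible.eq_or_eq_or_eq {i j k l x : Fin 4} (h : Admissible i j k l) (hx : i ≠ x) :
    x = j ∨ x = k ∨ x = l := by
  unfold Admissible at h
  omega

theorem Admissible.perm_cases {i j k l j' k' l' : Fin 4} (h : Admissible i j k l)
    (h' : Admissible i j' k' l') :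
    (j' = j ∧ k' = k ∧ l' = l) ∨ (j' = k ∧ k' = l ∧ l' = j) ∨ (j' = l ∧ k' = j ∧ l' = k) ∨
    (j' = l ∧ k' = k ∧ l' = j) ∨ (j' = k ∧ k' = j ∧ l' = l) ∨ (j' = j ∧ k' = l ∧ l' = k) := by
  obtain ⟨hj, hk, hl, hjk, hjl, hkl⟩ := h'
  rcases h.eq_or_eq_or_eq hj with rfl | rfl | rfl <;>
  rcases h.eq_or_eq_or_eq hk with rfl | rfl | rfl <;>
  rcases h.eq_or_eq_or_eq hl with rfl | rfl | rfl <;>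
  first | contradiction | simp

/-- The radial relations at `i` differ iff they differ on one fixed ordering of the other points. -/
theorem radial_differ_iff {P Q : Fin 4 → ℝ × ℝ} (hP : GenPos P) (hQ : GenPos Q)
    {i j k l : Fin 4} (h : Admissible i j k l) :
    (∃ j k l : Fin 4, Admissible i j k l ∧ Ccw P i j k l ∧ ¬ Ccw Q i j k l) ↔
      ¬ (Ccw P i j k l ↔ Ccw Q i j k l) := by
  have hrP := hP.ccw_reverse h
  have hrQ := hQ.ccw_reverse h
  constructor
  · rintro ⟨j', k', l', h', hp, hq⟩
    rcases h.perm_cases h' with ⟨rfl, rfl, rfl⟩ | ⟨rfl, rfl, rfl⟩ | ⟨rfl, rfl, rfl⟩ |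
      ⟨rfl, rfl, rfl⟩ | ⟨rfl, rfl, rfl⟩ | ⟨rfl, rfl, rfl⟩ <;>
    grind [ccw_rotate]
  · intro hne
    by_cases hp : Ccw P i j k l
    · exact ⟨j, k, l, h, hp, by tauto⟩
    · refine ⟨l, k, j, ?_, hrP.mpr hp, fun hq => hrQ.mp hq (by tauto)⟩
      obtain ⟨hij, hik, hil, hjk, hjl, hkl⟩ := h
      exact ⟨hil, hik, hij, hkl.symm, hjl.symm, hjk.symm⟩

/-- In a configuration of four points, evenly many points see the other three, listed in
increasing order, in counterclockwise order. -/
theorem GenPos.ccw_parity_s2 {P : Fin 4 → ℝ × ℝ} (h : GenPos P) :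
    (Ccw P 0 1 2 3 ↔ Ccw P 1 0 2 3) ↔ (Ccw P 2 0 1 3 ↔ Ccw P 3 0 1 2) := by
  have e1 : chi P 0 3 1 = -chi P 0 1 3 := chi_swap P 0 1 3
  have e2 : chi P 1 0 2 = -chi P 0 1 2 := by rw [chi_swap P 1 2 0, ← chi_rotate]
  have e3 : chi P 1 3 0 = chi P 0 1 3 := (chi_rotate P 0 1 3).symm
  have e4 : chi P 2 0 1 = chi P 0 1 2 := chi_rotate P 2 0 1
  have e5 : chi P 2 1 3 = -chi P 1 2 3 := by rw [chi_swap P 2 3 1, ← chi_rotate]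
  have e6 : chi P 2 3 0 = chi P 0 2 3 := (chi_rotate P 0 2 3).symm
  have e7 : chi P 3 0 1 = chi P 0 1 3 := chi_rotate P 3 0 1
  have e8 : chi P 3 1 2 = chi P 1 2 3 := chi_rotate P 3 1 2
  have e9 : chi P 3 2 0 = -chi P 0 2 3 := by rw [chi_swap P 3 0 2, chi_rotate]
  unfold Ccw
  rw [e1, e2, e3, e4, e5, e6, e7, e8, e9]
  rcases h.chi_eq (i := 0) (j := 1) (k := 2) (by decide) (by decide) (by decide) with ha | ha <;>
  rcases h.chi_eq (i := 0) (j := 1) (k := 3) (by decide) (by decide) (by decide) with hb | hb <;>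
  rcases h.chi_eq (i := 0) (j := 2) (k := 3) (by decide) (by decide) (by decide) with hc | hc <;>
  rcases h.chi_eq (i := 1) (j := 2) (k := 3) (by decide) (by decide) (by decide) with hd | hd <;>
  rw [ha, hb, hc, hd] <;> norm_num

open scoped Classical in
theorem even_ncard_setOf_fin_four (p : Fin 4 → Prop) (h : (p 0 ↔ p 1) ↔ (p 2 ↔ p 3)) :
    Even {i | p i}.ncard := by
  rw [Set.ncard_eq_toFinset_card', Set.toFinset_ofPred, Finset.card_filter, Fin.sum_univ_four]
  by_cases h0 : p 0 <;> by_cases h1 : p 1 <;> by_cases h2 : p 2 <;> by_cases h3 : p 3 <;>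
    simp [h0, h1, h2, h3] at h ⊢
  decide

/-- for 4-point configurations, the number of indices where the
counterclockwise radial relations of `P` and `Q` differ is even. -/
theorem radial_differ_even
    (P Q : Fin 4 → ℝ × ℝ)
    (hPinj : Function.Injective P) (hPgp : GenPos P)
    (hQinj : Function.Injective Q) (hQgp : GenPos Q) :
    Even {i : Fin 4 | ∃ j k l : Fin 4, Admissible i j k l ∧
            Ccw P i j k l ∧ ¬ Ccw Q i j k l}.ncard := by
  apply even_ncard_setOf_fin_four
  rw [radial_differ_iff hPgp hQgp (i := 0) (j := 1) (k := 2) (l := 3) (by unfold Admissible; decide),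
    radial_differ_iff hPgp hQgp (i := 1) (j := 0) (k := 2) (l := 3) (by unfold Admissible; decide),
    radial_differ_iff hPgp hQgp (i := 2) (j := 0) (k := 1) (l := 3) (by unfold Admissible; decide),
    radial_differ_iff hPgp hQgp (i := 3) (j := 0) (k := 1) (l := 2) (by unfold Admissible; decide)]
  have hp := hPgp.ccw_parity_s2
  have hq := hQgp.ccw_parity_s2
  grind
end
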